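/- (Finite-field Clausen formula.) Assume the characteristic p of κ is odd and let η be the quadratic character of κ. Let α, β be multiplicative characters of κ with α² ≠ ε, β² ≠ ε, αβ ≠ ε and α ≠ βη. Then for every λ ∈ κ*: F(α,β; αβη; λ)² + [1 if λ = 1, else 0]·(g°(αβη)·g(η)/(g(α)·g(β)))² = F(α², β², αβ; α²β², αβη; λ) + q · [g°(αβη)/(g(α)·g(β))] · [g°(αβη)/(g(αη)·g(βη))] · (αβ)(λ⁻¹)·η(1−λ⁻¹). -/

import Mathlib

/-!
Finite-field hypergeometric functions (Otsubo), basic definitions: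
`κ` is a finite field with `q = Fintype.card κ` elements, `ψ` a fixed nontrivial
additive character, multiplicative characters are `MulChar κ ℂ` (extended by `0`
on `0`, with trivial character `1`).
-/

open scoped Classical

noncomputable section

variable {κ : Type*} [Field κ] [Fintype κ]

instance : Fintype (MulChar κ ℂ) := Fintype.ofFinite _

/-- The Gauss sum `g(φ) = -∑_{x ∈ κ} ψ(x) φ(x)`. -/
def gS (ψ : AddChar κ ℂ) (φ : MulChar κ ℂ) : ℂ := -∑ x : κ, ψ x * φ x

/-- The variant `g°(φ) = q^{δ(φ)} · g(φ)`, where `δ(φ) = 1` iff `φ` is trivial. -/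
def gSo (ψ : AddChar κ ℂ) (φ : MulChar κ ℂ) : ℂ :=
  (if φ = 1 then (Fintype.card κ : ℂ) else 1) * gS ψ φ

/-- The Pochhammer symbol `(α)_ν = g(αν)/g(α)`. -/
def poch (ψ : AddChar κ ℂ) (α ν : MulChar κ ℂ) : ℂ := gS ψ (α * ν) / gS ψ α

/-- The variant Pochhammer symbol `(α)°_ν = g°(αν)/g°(α)`. -/
def pocho (ψ : AddChar κ ℂ) (α ν : MulChar κ ℂ) : ℂ := gSo ψ (α * ν) / gSo ψ α

/-- The finite hypergeometric function
`F(α₁,…,α_r; β₁,…,β_s; λ) = (1/(1-q)) ∑_ν ((α₁)_ν ⋯ (α_r)_ν / ((ε)°_ν (β₁)°_ν ⋯ (β_s)°_ν)) ν(λ)`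
(the trivial character `ε = 1` appears implicitly among the lower parameters). -/
def Fh (ψ : AddChar κ ℂ) {r s : ℕ} (A : Fin r → MulChar κ ℂ) (B : Fin s → MulChar κ ℂ)
    (l : κ) : ℂ :=
  (1 - (Fintype.card κ : ℂ))⁻¹ *
    ∑ ν : MulChar κ ℂ,
      ((∏ i, poch ψ (A i) ν) / (pocho ψ 1 ν * ∏ j, pocho ψ (B j) ν)) * ν l

lemma card_ne_zero_complex : (Fintype.card κ : ℂ) ≠ 0 := by
  exact_mod_cast Fintype.card_ne_zero

lemma one_sub_card_ne_zero : (1 - (Fintype.card κ : ℂ)) ≠ 0 := by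
  have h : 1 < Fintype.card κ := Fintype.one_lt_card
  rw [sub_ne_zero]
  exact_mod_cast h.ne

lemma gS_eq_neg_gaussSum (ψ : AddChar κ ℂ) (φ : MulChar κ ℂ) : gS ψ φ = -gaussSum φ ψ := by
  simp [gS, gaussSum, mul_comm]

lemma gS_one {ψ : AddChar κ ℂ} (hψ : ψ ≠ 1) : gS ψ 1 = 1 := by
  rw [gS_eq_neg_gaussSum, gaussSum_one_left hψ, neg_neg]

lemma gSo_of_ne_one (ψ : AddChar κ ℂ) {φ : MulChar κ ℂ} (h : φ ≠ 1) : gSo ψ φ = gS ψ φ := by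
  simp [gSo, h]

lemma gSo_one {ψ : AddChar κ ℂ} (hψ : ψ ≠ 1) : gSo ψ (1 : MulChar κ ℂ) = Fintype.card κ := by
  simp [gSo, gS_one hψ]

lemma mulChar_neg_one_sq {F : Type*} [Field F] (φ : MulChar F ℂ) : φ (-1) * φ (-1) = 1 := by
  rw [← map_mul]; simp

/-- The reflection formula `g°(φ) g(φ⁻¹) = φ(-1) q`. -/
lemma gSo_mul_gS_inv {ψ : AddChar κ ℂ} (hψ : ψ ≠ 1) (φ : MulChar κ ℂ) :
    gSo ψ φ * gS ψ φ⁻¹ = φ (-1) * Fintype.card κ := by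
  by_cases h : φ = 1
  · subst h
    simp [gSo_one hψ, gS_one hψ, MulChar.one_apply]
  · rw [gSo_of_ne_one ψ h, gS_eq_neg_gaussSum, gS_eq_neg_gaussSum,
      ← gaussSum_mul_gaussSum_eq_card h (AddChar.IsPrimitive.of_ne_one hψ),
      ← mul_gaussSum_inv_eq_gaussSum φ⁻¹ ψ, MulChar.inv_apply']
    simp only [inv_neg, inv_one]
    ring

lemma gS_ne_zero {ψ : AddChar κ ℂ} (hψ : ψ ≠ 1) (φ : MulChar κ ℂ) : gS ψ φ ≠ 0 := by
  intro h
  have := gSo_mul_gS_inv hψ φ⁻¹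
  rw [inv_inv, h, mul_zero] at this
  have h2 : (φ⁻¹ : MulChar κ ℂ) (-1) ≠ 0 := fun h0 => by
    have := mulChar_neg_one_sq φ⁻¹
    simp [h0] at this
  exact mul_ne_zero h2 (card_ne_zero_complex (κ := κ)) this.symm

lemma gSo_ne_zero {ψ : AddChar κ ℂ} (hψ : ψ ≠ 1) (φ : MulChar κ ℂ) : gSo ψ φ ≠ 0 := by
  unfold gSo
  split_ifs
  · exact mul_ne_zero card_ne_zero_complex (gS_ne_zero hψ φ)
  · simpa using gS_ne_zero hψ φ

/-- Jacobi sums in terms of Gauss sums, including the degenerate cases. -/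
lemma jacobiSum_mul_gSo {ψ : AddChar κ ℂ} (hψ : ψ ≠ 1) (φ : MulChar κ ℂ) {χ : MulChar κ ℂ}
    (hχ : χ ≠ 1) : jacobiSum φ χ * gSo ψ (φ * χ) = -(gS ψ φ * gS ψ χ) := by
  by_cases h : φ * χ = 1
  · obtain rfl : φ = χ⁻¹ := eq_inv_of_mul_eq_one_left h
    rw [h, gSo_one hψ, jacobiSum_comm, jacobiSum_nontrivial_inv hχ, mul_comm (gS ψ χ⁻¹),
      ← gSo_of_ne_one ψ hχ, gSo_mul_gS_inv hψ, neg_mul]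
  · rw [gSo_of_ne_one ψ h, gS_eq_neg_gaussSum, gS_eq_neg_gaussSum, gS_eq_neg_gaussSum]
    linear_combination -jacobiSum_mul_nontrivial h ψ

lemma sum_mulChar_apply_of_ne_one {a : κ} (ha : a ≠ 1) : ∑ ν : MulChar κ ℂ, ν a = 0 := by
  obtain ⟨χ, hχ⟩ := MulChar.exists_apply_ne_one_of_hasEnoughRootsOfUnity κ ℂ ha
  refine eq_zero_of_mul_eq_self_left hχ ?_
  simp only [Finset.mul_sum, ← MulChar.mul_apply]
  exact Fintype.sum_bijective _ (Group.mulLeft_bijective χ) _ _ fun _ => rfl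

lemma sum_mulChar_apply (a : κ) :
    ∑ ν : MulChar κ ℂ, ν a = if a = 1 then (Fintype.card κ : ℂ) - 1 else 0 := by
  split_ifs with h
  · subst h
    have h1 := MulChar.card_eq_card_units_of_hasEnoughRootsOfUnity κ ℂ
    rw [Nat.card_eq_fintype_card, Nat.card_eq_fintype_card] at h1
    rw [Fintype.card_eq_card_units_add_one (α := κ)]
    simp [h1]
  · exact sum_mulChar_apply_of_ne_one h

lemma poch_div_pocho_one {ψ : AddChar κ ℂ} (hψ : ψ ≠ 1) {α : MulChar κ ℂ} (hα : α ≠ 1)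
    (ν : MulChar κ ℂ) :
    poch ψ α ν / pocho ψ 1 ν = -(jacobiSum (α * ν) ν⁻¹ * ν (-1)) := by
  have hJ : jacobiSum (α * ν) ν⁻¹ * gS ψ α = -(gS ψ (α * ν) * gS ψ ν⁻¹) := by
    by_cases hν : ν = 1
    · subst hν
      have := jacobiSum_mul_gSo hψ 1 hα
      rw [one_mul, gSo_of_ne_one ψ hα] at this
      rw [inv_one, mul_one, jacobiSum_comm, this, mul_comm]
    · have := jacobiSum_mul_gSo hψ (α * ν) (inv_ne_one.mpr hν)
      rwa [mul_inv_cancel_right, gSo_of_ne_one ψ hα] at this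
  have hr := gSo_mul_gS_inv hψ ν
  have hs := mulChar_neg_one_sq ν
  have h1 := gS_ne_zero hψ α
  have h2 := gSo_ne_zero hψ ν
  have h3 := card_ne_zero_complex (κ := κ)
  rw [poch, pocho, one_mul, gSo_one hψ]
  field_simp
  linear_combination (ν (-1) * gSo ψ ν) * hJ + (-gS ψ (α * ν) * ν (-1)) * hr +
    (-gS ψ (α * ν) * Fintype.card κ) * hs

/-- The binomial theorem `F(α; ; x) = α⁻¹(1 - x)`. -/
lemma sum_poch_div_pocho_one {ψ : AddChar κ ℂ} (hψ : ψ ≠ 1) {α : MulChar κ ℂ} (hα : α ≠ 1)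
    {x : κ} (hx : x ≠ 0) :
    ∑ ν : MulChar κ ℂ, poch ψ α ν / pocho ψ 1 ν * ν x
      = (1 - (Fintype.card κ : ℂ)) * α⁻¹ (1 - x) := by
  have h : ∀ ν : MulChar κ ℂ, poch ψ α ν / pocho ψ 1 ν * ν x =
      ∑ t : κ, -α t * ν (-(t * x) * (1 - t)⁻¹) := fun ν => by
    rw [poch_div_pocho_one hψ hα, jacobiSum, Finset.sum_mul, ← Finset.sum_neg_distrib,
      Finset.sum_mul]
    refine Finset.sum_congr rfl fun t _ => ?_
    rw [MulChar.inv_apply', MulChar.mul_apply, neg_eq_neg_one_mul (t * x)]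
    simp only [map_mul]
    ring
  simp_rw [h]
  rw [Finset.sum_comm]
  simp_rw [← Finset.mul_sum, sum_mulChar_apply]
  rw [Finset.sum_eq_single (1 - x)⁻¹]
  · rw [MulChar.inv_apply']
    by_cases hx1 : x = 1
    · subst hx1; simp [MulChar.map_zero]
    · have h1 : 1 - x ≠ 0 := sub_ne_zero.mpr (Ne.symm hx1)
      rw [if_pos]
      · ring
      · have : 1 - (1 - x)⁻¹ = -x / (1 - x) := by field_simp; ring
        rw [this]
        field_simp
  · intro t _ ht
    rw [if_neg, mul_zero]
    intro h0
    apply ht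
    have h1 : 1 - t ≠ 0 := fun h1 => by simp [h1] at h0
    rw [mul_inv_eq_one₀ h1] at h0
    exact eq_inv_of_mul_eq_one_left (by linear_combination h0)
  · simp

/-- The coefficient form of Euler's integral. -/
lemma poch_div_pocho {ψ : AddChar κ ℂ} (hψ : ψ ≠ 1) (β ν : MulChar κ ℂ) {χ : MulChar κ ℂ}
    (hχ : χ ≠ 1) :
    poch ψ β ν / pocho ψ (β * χ) ν =
      -(gSo ψ (β * χ) / (gS ψ β * gS ψ χ)) * jacobiSum (β * ν) χ := by
  have h := jacobiSum_mul_gSo hψ (β * ν) hχ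
  rw [mul_right_comm] at h
  have h1 := gS_ne_zero hψ β
  have h2 := gSo_ne_zero hψ (β * χ * ν)
  have h3 := gS_ne_zero hψ χ
  rw [poch, pocho]
  have h4 := gSo_ne_zero hψ (β * χ)
  field_simp
  linear_combination h

lemma sum_mul_poch_div_pocho {ψ : AddChar κ ℂ} (hψ : ψ ≠ 1) (β : MulChar κ ℂ) {χ : MulChar κ ℂ}
    (hχ : χ ≠ 1) (c : MulChar κ ℂ → ℂ) (l : κ) :
    ∑ ν : MulChar κ ℂ, c ν * (poch ψ β ν / pocho ψ (β * χ) ν) * ν l =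
      -(gSo ψ (β * χ) / (gS ψ β * gS ψ χ)) *
        ∑ x : κ, β x * χ (1 - x) * ∑ ν : MulChar κ ℂ, c ν * ν (x * l) := by
  simp_rw [poch_div_pocho hψ β _ hχ, jacobiSum, Finset.mul_sum, Finset.sum_mul]
  rw [Finset.sum_comm]
  refine Finset.sum_congr rfl fun x _ => Finset.sum_congr rfl fun ν _ => ?_
  simp only [map_mul, MulChar.mul_apply]
  ring

/-- Euler's integral representation of `₂F₁`. -/
lemma Fh_two_one_eq_sum {ψ : AddChar κ ℂ} (hψ : ψ ≠ 1) {α : MulChar κ ℂ} (β : MulChar κ ℂ)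
    {χ : MulChar κ ℂ} (hα : α ≠ 1) (hχ : χ ≠ 1) {l : κ} (hl : l ≠ 0) :
    Fh ψ ![α, β] ![β * χ] l = -(gSo ψ (β * χ) / (gS ψ β * gS ψ χ)) *
        ∑ x : κ, β x * χ (1 - x) * α⁻¹ (1 - x * l) := by
  have h := sum_mul_poch_div_pocho hψ β hχ (fun ν => poch ψ α ν / pocho ψ 1 ν) l
  have h' : ∀ x : κ, β x * χ (1 - x) * ∑ ν : MulChar κ ℂ, poch ψ α ν / pocho ψ 1 ν * ν (x * l) =
      (1 - (Fintype.card κ : ℂ)) * (β x * χ (1 - x) * α⁻¹ (1 - x * l)) := fun x => by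
    by_cases hx : x = 0
    · simp [hx, MulChar.map_zero]
    · rw [sum_poch_div_pocho_one hψ hα (mul_ne_zero hx hl)]
      ring
  simp only [h', ← Finset.mul_sum] at h
  have hq := one_sub_card_ne_zero (κ := κ)
  rw [Fh, inv_mul_eq_iff_eq_mul₀ hq]
  convert h using 1
  · refine Finset.sum_congr rfl fun ν _ => ?_
    simp [Fin.prod_univ_succ, mul_div_mul_comm]
  · ring

/-- Euler's integral representation of `₃F₂`. -/
lemma Fh_three_two_eq_sum {ψ : AddChar κ ℂ} (hψ : ψ ≠ 1) {α : MulChar κ ℂ} (β γ : MulChar κ ℂ)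
    {χ ξ : MulChar κ ℂ} (hα : α ≠ 1) (hχ : χ ≠ 1) (hξ : ξ ≠ 1) {l : κ} (hl : l ≠ 0) :
    Fh ψ ![α, β, γ] ![β * χ, γ * ξ] l =
      gSo ψ (β * χ) / (gS ψ β * gS ψ χ) * (gSo ψ (γ * ξ) / (gS ψ γ * gS ψ ξ)) *
        ∑ y : κ, γ y * ξ (1 - y) * ∑ x : κ, β x * χ (1 - x) * α⁻¹ (1 - x * (y * l)) := by
  have h := sum_mul_poch_div_pocho hψ γ hξ
    (fun ν => poch ψ α ν / pocho ψ 1 ν * (poch ψ β ν / pocho ψ (β * χ) ν)) l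
  have h' : ∀ y : κ, γ y * ξ (1 - y) * ∑ ν : MulChar κ ℂ,
      poch ψ α ν / pocho ψ 1 ν * (poch ψ β ν / pocho ψ (β * χ) ν) * ν (y * l) =
      (1 - (Fintype.card κ : ℂ)) * -(gSo ψ (β * χ) / (gS ψ β * gS ψ χ)) *
        (γ y * ξ (1 - y) * ∑ x : κ, β x * χ (1 - x) * α⁻¹ (1 - x * (y * l))) := fun y => by
    by_cases hy : y = 0
    · simp [hy, MulChar.map_zero]
    · have h2 := Fh_two_one_eq_sum hψ β hα hχ (mul_ne_zero hy hl)
      have hq := one_sub_card_ne_zero (κ := κ)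
      rw [Fh, inv_mul_eq_iff_eq_mul₀ hq] at h2
      simp only [Fin.prod_univ_two, Matrix.cons_val_zero, Matrix.cons_val_one,
        Finset.univ_unique, Finset.prod_const, Finset.card_singleton, pow_one,
        Matrix.cons_val_fin_one, mul_div_mul_comm] at h2
      rw [h2]
      ring
  simp only [h', ← Finset.mul_sum] at h
  have hq := one_sub_card_ne_zero (κ := κ)
  rw [Fh, inv_mul_eq_iff_eq_mul₀ hq]
  convert h using 1
  · refine Finset.sum_congr rfl fun ν _ => ?_
    simp [Fin.prod_univ_succ, mul_div_mul_comm, mul_assoc]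
  · ring

lemma eq_quadraticChar {η : MulChar κ ℂ} (hη2 : η ^ 2 = 1) (hη1 : η ≠ 1)
    (x : κ) : η x = (quadraticChar κ x : ℤ) := by
  have hsq : ∀ y : κ, y ≠ 0 → η (y * y) = 1 := fun y hy => by
    rw [map_mul, ← pow_two, ← MulChar.pow_apply' η two_ne_zero, hη2,
      MulChar.one_apply (isUnit_iff_ne_zero.mpr hy)]
  by_cases hx : x = 0
  · simp [hx, MulChar.map_zero]
  by_cases hs : IsSquare x
  · rw [(quadraticChar_one_iff_isSquare hx).mpr hs]
    obtain ⟨y, rfl⟩ := hs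
    rw [hsq y fun h => hx (by simp [h])]
    simp
  · obtain ⟨u, hu⟩ : ∃ u : κˣ, η u ≠ 1 := by
      by_contra! h
      exact hη1 (MulChar.ext fun u => by rw [h u, MulChar.one_apply_coe])
    have hus : ¬ IsSquare (u : κ) := by
      rintro ⟨y, hy⟩
      exact hu (by rw [hy, hsq y fun h => u.ne_zero (by simp [hy, h])])
    have h1 := quadraticChar_neg_one_iff_not_isSquare.mpr hs
    have h2 := quadraticChar_neg_one_iff_not_isSquare.mpr hus
    have h3 : quadraticChar κ (x * u) = 1 := by rw [map_mul, h1, h2]; norm_num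
    obtain ⟨y, hy⟩ := (quadraticChar_one_iff_isSquare (mul_ne_zero hx u.ne_zero)).mp h3
    have h4 : η x * η u = 1 := by
      rw [← map_mul, hy, hsq y fun h => mul_ne_zero hx u.ne_zero (by simp [hy, h])]
    have h5 : η u * η u = 1 := by rw [← map_mul, hsq _ u.ne_zero]
    have h6 : η u = -1 := (mul_self_eq_one_iff.mp h5).resolve_left hu
    rw [h1]
    rw [h6] at h4
    push_cast
    linear_combination -h4

lemma sum_sqrt_eq (hp : ringChar κ ≠ 2) {η : MulChar κ ℂ} (hη2 : η ^ 2 = 1) (hη1 : η ≠ 1)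
    (a : κ) : ∑ y : κ, (if y ^ 2 = a then (1 : ℂ) else 0) = 1 + η a := by
  have h := quadraticChar_card_sqrts hp a
  rw [eq_quadraticChar hη2 hη1, Finset.sum_boole]
  rw [Set.toFinset_ofPred] at h
  have h' : (((Finset.univ.filter fun y : κ => y ^ 2 = a).card : ℤ) : ℂ) =
    ((quadraticChar κ a + 1 : ℤ) : ℂ) := by rw [← h]
  push_cast at h'
  rw [h', add_comm]

lemma sum_comp_sq (hp : ringChar κ ≠ 2) {η : MulChar κ ℂ} (hη2 : η ^ 2 = 1) (hη1 : η ≠ 1)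
    (f : κ → ℂ) : ∑ y : κ, f (y ^ 2) = ∑ z : κ, (1 + η z) * f z := by
  simp_rw [← sum_sqrt_eq hp hη2 hη1, Finset.sum_mul]
  rw [Finset.sum_comm]
  simp

lemma quadratic_mul_self {F : Type*} [Field F] {η : MulChar F ℂ} (hη2 : η ^ 2 = 1) {x : F} (hx : x ≠ 0) :
    η x * η x = 1 := by
  rw [← pow_two, ← MulChar.pow_apply' η two_ne_zero, hη2,
    MulChar.one_apply (isUnit_iff_ne_zero.mpr hx)]

lemma sum_one_sub_eq_zero {φ : MulChar κ ℂ} (hφ : φ ≠ 1) : ∑ x : κ, φ (1 - x) = 0 := by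
  rw [← MulChar.sum_eq_zero_of_ne_one hφ]
  exact (Equiv.subLeft (1 : κ)).sum_comp φ

/-- The duplication formula for Gauss sums. -/
lemma gS_duplication (hp : ringChar κ ≠ 2) {ψ : AddChar κ ℂ} (hψ : ψ ≠ 1)
    {η : MulChar κ ℂ} (hη2 : η ^ 2 = 1) (hη1 : η ≠ 1) {φ : MulChar κ ℂ} (hφ : φ ≠ 1) :
    φ 4 * gS ψ φ * gSo ψ (φ * η) = gS ψ η * gSo ψ (φ ^ 2) := by
  have h2 : (2 : κ) ≠ 0 := Ring.two_ne_zero hp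
  have hJ : φ 4 * jacobiSum φ φ = jacobiSum φ η := by
    have e1 : φ 4 * jacobiSum φ φ = ∑ x : κ, φ (1 - (1 - 2 * x) ^ 2) := by
      rw [jacobiSum, Finset.mul_sum]
      refine Finset.sum_congr rfl fun x _ => ?_
      rw [← map_mul, ← map_mul]
      congr 1
      ring
    have e2 : ∑ x : κ, φ (1 - (1 - 2 * x) ^ 2) = ∑ y : κ, φ (1 - y ^ 2) :=
      Fintype.sum_equiv ((Equiv.mulLeft₀ 2 h2).trans (Equiv.subLeft 1)) _ _ fun x => by simp
    rw [e1, e2, sum_comp_sq hp hη2 hη1 (fun z => φ (1 - z)), jacobiSum_comm, jacobiSum]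
    simp_rw [add_mul, Finset.sum_add_distrib, one_mul]
    rw [sum_one_sub_eq_zero hφ, zero_add]
  have h1 := jacobiSum_mul_gSo hψ φ hφ
  have h3 := jacobiSum_mul_gSo hψ φ hη1
  rw [← pow_two φ] at h1
  refine mul_left_cancel₀ (gS_ne_zero hψ φ) ?_
  linear_combination φ 4 * gSo ψ (φ * η) * h1 - gSo ψ (φ * η) * gSo ψ (φ ^ 2) * hJ
    - gSo ψ (φ ^ 2) * h3

lemma quadratic_mul_sq {F : Type*} [Field F] {η : MulChar F ℂ} (hη2 : η ^ 2 = 1) (a : F) {x : F}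
    (hx : x ≠ 0) : η (a * x ^ 2) = η a := by
  rw [map_mul, map_pow, pow_two, quadratic_mul_self hη2 hx, mul_one]

lemma quadratic_inv {F : Type*} [Field F] {η : MulChar F ℂ} (hη2 : η ^ 2 = 1) (x : F) :
    η x⁻¹ = η x := by
  rw [← MulChar.inv_apply', inv_eq_of_mul_eq_one_left ((pow_two η).symm.trans hη2)]

lemma mulChar_map_inv {F : Type*} [Field F] (φ : MulChar F ℂ) (x : F) : φ x⁻¹ = (φ x)⁻¹ :=
  map_inv₀ φ.toMonoidWithZeroHom x

lemma sum_quadratic_one_sub_mul_sq (hp : ringChar κ ≠ 2) {η : MulChar κ ℂ} (hη2 : η ^ 2 = 1)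
    (hη1 : η ≠ 1) {k : κ} (hk : k ≠ 0) : ∑ y : κ, η (1 - k * y ^ 2) = -η (-k) := by
  rw [sum_comp_sq hp hη2 hη1 (fun z => η (1 - k * z))]
  have h1 : ∑ z : κ, η (1 - k * z) = 0 := by
    rw [← sum_one_sub_eq_zero hη1]
    exact Equiv.sum_comp (Equiv.mulLeft₀ k hk) (fun z => η (1 - z))
  have h2 : ∀ z : κ, η z * η (1 - k * z) = η (z⁻¹ - k) - if z = 0 then η (-k) else 0 := fun z => by
    by_cases hz : z = 0
    · simp [hz, MulChar.map_zero]
    · rw [if_neg hz, sub_zero, ← map_mul, ← quadratic_mul_sq hη2 (z⁻¹ - k) hz]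
      congr 1
      field_simp
  have h3 : ∑ z : κ, η (z⁻¹ - k) = 0 := by
    rw [← MulChar.sum_eq_zero_of_ne_one hη1]
    exact Equiv.sum_comp ((Equiv.inv κ).trans (Equiv.subRight k)) (fun z => η z)
  simp_rw [add_mul, Finset.sum_add_distrib, one_mul, h1, h2, Finset.sum_sub_distrib, h3]
  simp

/-- The summand in the double character sum expressing `F(α², β², αβ; α²β², αβη; l)`. -/
def eulerTerm {F : Type*} [Field F] (α β η : MulChar F ℂ) (l : F) (p : F × F) : ℂ :=
  (α * β) p.1 * η (1 - p.1) *
    ((β ^ 2) p.2 * (α ^ 2) (1 - p.2) * (α ^ 2)⁻¹ (1 - p.2 * (p.1 * l)))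

/-- The term `eulerTerm` after the substitution `b = x y²`, `c = x y (1 - y) / (1 - l x y)`. -/
def sqrtTerm {F : Type*} [Field F] (α β η : MulChar F ℂ) (l : F) (p : F × F) : ℂ :=
  α (p.2 ^ 2 / p.1) * β p.1 *
    η (1 + p.2 ^ 2 * l ^ 2 - p.2 ^ 2 / p.1 - p.1 - 2 * p.2 * (1 - l))

lemma sum_eulerTerm_filter {η : MulChar κ ℂ} (hη2 : η ^ 2 = 1) (α β : MulChar κ ℂ) (l : κ) :
    ∑ p with (p : κ × κ).1 ≠ 0 ∧ p.2 ≠ 0 ∧ 1 - p.2 ≠ 0 ∧ 1 - p.2 * (p.1 * l) ≠ 0 ∧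
        1 - l * p.1 * p.2 ^ 2 ≠ 0, eulerTerm α β η l p =
      ∑ p with (p : κ × κ).1 ≠ 0 ∧ p.2 ≠ 0 ∧ 1 - p.1 * l ≠ 0 ∧ p.1 + p.2 ≠ 0 ∧ 1 + p.2 * l ≠ 0,
        sqrtTerm α β η l p := by
  have e1 : ∀ {x y d : κ}, d ≠ 0 → 1 - y * (x * l) = d →
      x * y ^ 2 + x * y * (1 - y) / d = x * y * (1 - l * x * y ^ 2) / d := fun hd h => by
    field_simp
    rw [← h]
    ring
  have e2 : ∀ {x y d : κ}, d ≠ 0 → 1 - y * (x * l) = d →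
      1 + x * y * (1 - y) / d * l = (1 - l * x * y ^ 2) / d := fun hd h => by
    field_simp
    rw [← h]
    ring
  have e3 : ∀ {b c s t : κ}, s ≠ 0 → b + c = s → 1 + c * l = t →
      1 - b * t / s = c * (1 - b * l) / s := fun hs h h' => by
    field_simp
    rw [← h, ← h']
    ring
  have e4 : ∀ {b c s t : κ}, b ≠ 0 → s ≠ 0 → t ≠ 0 → b + c = s → 1 + c * l = t →
      1 - b * t / s * (s ^ 2 / (b * t ^ 2) * l) = (1 - b * l) / t := fun hb hs ht h h' => by
    field_simp
    rw [← h, ← h']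
    ring
  refine Finset.sum_nbij'
    (fun p => (p.1 * p.2 ^ 2, p.1 * p.2 * (1 - p.2) / (1 - p.2 * (p.1 * l))))
    (fun p => ((p.1 + p.2) ^ 2 / (p.1 * (1 + p.2 * l) ^ 2),
      p.1 * (1 + p.2 * l) / (p.1 + p.2))) ?_ ?_ ?_ ?_ ?_
  · rintro ⟨x, y⟩ h
    simp only [Finset.mem_filter, Finset.mem_univ, true_and] at h ⊢
    obtain ⟨hx, hy, hy1, hd, hb⟩ := h
    rw [e1 hd rfl, e2 hd rfl]
    refine ⟨by positivity, by positivity, ?_, by positivity, by positivity⟩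
    convert hb using 1
    ring
  · rintro ⟨b, c⟩ h
    simp only [Finset.mem_filter, Finset.mem_univ, true_and] at h ⊢
    obtain ⟨hb, hc, hbl, hbc, hcl⟩ := h
    rw [e3 hbc rfl rfl, e4 hb hbc hcl rfl rfl]
    refine ⟨by positivity, by positivity, by positivity, by positivity, ?_⟩
    convert hbl using 1
    generalize 1 + c * l = t at hcl
    field_simp
  · rintro ⟨x, y⟩ h
    simp only [Finset.mem_filter, Finset.mem_univ, true_and] at h ⊢
    obtain ⟨hx, hy, hy1, hd, hb⟩ := h
    rw [e1 hd rfl, e2 hd rfl]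
    generalize 1 - y * (x * l) = d at hd
    generalize 1 - l * x * y ^ 2 = t at hb
    ext <;> simp only <;> field_simp
  · rintro ⟨b, c⟩ h
    simp only [Finset.mem_filter, Finset.mem_univ, true_and] at h ⊢
    obtain ⟨hb, hc, hbl, hbc, hcl⟩ := h
    rw [e3 hbc rfl rfl, e4 hb hbc hcl rfl rfl]
    generalize 1 + c * l = t at hcl
    generalize 1 - b * l = r at hbl
    ext <;> simp only <;> field_simp
  · rintro ⟨x, y⟩ h
    simp only [Finset.mem_filter, Finset.mem_univ, true_and] at h
    obtain ⟨hx, hy, hy1, hd, hb⟩ := h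
    have e5 : (x * y * (1 - y) / (1 - y * (x * l))) ^ 2 / (x * y ^ 2) =
        x * (1 - y) ^ 2 * ((1 - y * (x * l))⁻¹) ^ 2 := by
      generalize 1 - y * (x * l) = d at hd
      field_simp
    have e6 : 1 + (x * y * (1 - y) / (1 - y * (x * l))) ^ 2 * l ^ 2 -
        x * (1 - y) ^ 2 * ((1 - y * (x * l))⁻¹) ^ 2 - x * y ^ 2 -
        2 * (x * y * (1 - y) / (1 - y * (x * l))) * (1 - l) =
        (1 - x) * ((1 - l * x * y ^ 2) / (1 - y * (x * l))) ^ 2 := by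
      generalize h : 1 - y * (x * l) = d at hd
      field_simp
      rw [← h]
      ring
    simp only [eulerTerm, sqrtTerm, e5, e6, quadratic_mul_sq hη2 (1 - x) (div_ne_zero hb hd),
      MulChar.inv_apply', MulChar.mul_apply, MulChar.pow_apply' _ two_ne_zero, map_mul, map_pow]
    ring

lemma sum_eulerTerm_eq (hp : ringChar κ ≠ 2) {η : MulChar κ ℂ} (hη2 : η ^ 2 = 1) (hη1 : η ≠ 1)
    (α β : MulChar κ ℂ) {l : κ} (hl : l ≠ 0) :
    ∑ p, eulerTerm α β η l p =
      ∑ p with (p : κ × κ).1 ≠ 0 ∧ p.2 ≠ 0 ∧ 1 - p.2 ≠ 0 ∧ 1 - p.2 * (p.1 * l) ≠ 0 ∧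
        1 - l * p.1 * p.2 ^ 2 ≠ 0, eulerTerm α β η l p +
      (α * β) l⁻¹ * (-η (-l⁻¹) - 1 - η (1 - l⁻¹)) := by
  have hsplit : ∀ p : κ × κ, eulerTerm α β η l p =
      (if p.1 ≠ 0 ∧ p.2 ≠ 0 ∧ 1 - p.2 ≠ 0 ∧ 1 - p.2 * (p.1 * l) ≠ 0 ∧
        1 - l * p.1 * p.2 ^ 2 ≠ 0 then eulerTerm α β η l p else 0) +
      if 1 - l * p.1 * p.2 ^ 2 = 0 then eulerTerm α β η l p else 0 := by
    rintro ⟨x, y⟩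
    by_cases h : 1 - l * x * y ^ 2 = 0
    · simp [h]
    by_cases hx : x = 0
    · simp [eulerTerm, hx, MulChar.map_zero]
    by_cases hy : y = 0
    · simp [eulerTerm, hy, MulChar.map_zero]
    by_cases hy1 : 1 - y = 0
    · simp [eulerTerm, hy1, MulChar.map_zero]
    by_cases hd : 1 - y * (x * l) = 0
    · simp [eulerTerm, hd, MulChar.map_zero]
    simp [h, hx, hy, hy1, hd]
  have hcurve : ∀ y : κ, ∑ x : κ, (if 1 - l * x * y ^ 2 = 0 then eulerTerm α β η l (x, y) else 0) =
      (α * β) l⁻¹ * (η (1 - l⁻¹ * y⁻¹ ^ 2) - (if y = 0 then 1 else 0) -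
        if y = 1 then η (1 - l⁻¹) else 0) := fun y => by
    by_cases hy : y = 0
    · simp [hy]
    have hiff : ∀ x : κ, 1 - l * x * y ^ 2 = 0 ↔ x = l⁻¹ * y⁻¹ ^ 2 := fun x => by
      constructor
      · intro h
        field_simp
        linear_combination -h
      · rintro rfl
        field_simp
        ring
    simp_rw [hiff]
    rw [Finset.sum_ite_eq' Finset.univ, if_pos (Finset.mem_univ _), if_neg hy]
    by_cases hy1 : y = 1
    · simp [eulerTerm, hy1, MulChar.map_zero]
    rw [if_neg hy1]
    have e1 : 1 - y * (l⁻¹ * y⁻¹ ^ 2 * l) = (1 - y) * (-1) * y⁻¹ := by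
      field_simp
      ring
    have hu : 1 - y ≠ 0 := sub_ne_zero.2 (Ne.symm hy1)
    have ha : α (1 - y) ≠ 0 := (hu.isUnit.map α).ne_zero
    have hay : α y ≠ 0 := ((Ne.isUnit hy).map α).ne_zero
    have hby : β y ≠ 0 := ((Ne.isUnit hy).map β).ne_zero
    have hm : α (-1) * α (-1) = 1 := by rw [← map_mul, neg_one_mul, neg_neg, map_one]
    have hm0 : α (-1) ≠ 0 := left_ne_zero_of_mul_eq_one hm
    simp only [eulerTerm, e1, MulChar.inv_apply', MulChar.mul_apply,
      MulChar.pow_apply' _ two_ne_zero, map_mul, map_pow, mulChar_map_inv]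
    field_simp
    linear_combination -(α l)⁻¹ * (β l)⁻¹ * η ((l * y ^ 2 - 1) / (l * y ^ 2)) * hm
  rw [Finset.sum_congr rfl fun p _ => hsplit p, Finset.sum_add_distrib, Finset.sum_filter]
  congr 1
  rw [Fintype.sum_prod_type_right]
  simp_rw [hcurve, ← Finset.mul_sum, Finset.sum_sub_distrib]
  have hsum : ∑ y : κ, η (1 - l⁻¹ * y⁻¹ ^ 2) = -η (-l⁻¹) :=
    (Equiv.sum_comp (Equiv.inv κ) (fun y : κ => η (1 - l⁻¹ * y ^ 2))).trans
      (sum_quadratic_one_sub_mul_sq hp hη2 hη1 (inv_ne_zero hl))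
  rw [hsum]
  simp

lemma sum_sqrtTerm_inv_left {η : MulChar κ ℂ} (hη2 : η ^ 2 = 1) {α : MulChar κ ℂ}
    (β : MulChar κ ℂ) (h1 : α ^ 2 ≠ 1) {l : κ} (hl : l ≠ 0) :
    ∑ c, sqrtTerm α β η l (l⁻¹, c) = -((α * β) l⁻¹ * η (1 - l⁻¹)) := by
  have key : ∀ c : κ, sqrtTerm α β η l (l⁻¹, c) = α l * β l⁻¹ * η (1 - l⁻¹) *
      ((α ^ 2) c - if c = -l⁻¹ then (α ^ 2) (-l⁻¹) else 0) := fun c => by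
    have e1 : 1 + c ^ 2 * l ^ 2 - c ^ 2 / l⁻¹ - l⁻¹ - 2 * c * (1 - l) =
        (1 - l⁻¹) * (1 + c * l) ^ 2 := by
      field_simp
      ring
    simp only [sqrtTerm, e1]
    by_cases hc : c = -l⁻¹
    · have : 1 + c * l = 0 := by rw [hc]; field_simp; ring
      rw [this, if_pos hc, hc]
      simp [MulChar.map_zero]
    · have : 1 + c * l ≠ 0 := fun h => hc (by field_simp; linear_combination h)
      rw [quadratic_mul_sq hη2 _ this, if_neg hc, div_inv_eq_mul]
      simp only [map_mul, map_pow, MulChar.pow_apply' _ two_ne_zero]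
      ring
  simp_rw [key, ← Finset.mul_sum, Finset.sum_sub_distrib]
  rw [MulChar.sum_eq_zero_of_ne_one h1]
  have hal : α l ≠ 0 := (hl.isUnit.map α).ne_zero
  have hm : (α ^ 2) (-l⁻¹) = (α l)⁻¹ ^ 2 := by
    rw [MulChar.pow_apply' _ two_ne_zero, ← map_pow, neg_sq, map_pow, mulChar_map_inv]
  simp only [Finset.sum_ite_eq', Finset.mem_univ, if_true, hm, MulChar.mul_apply, mulChar_map_inv]
  field_simp
  ring

lemma sum_sqrtTerm_antidiagonal {η : MulChar κ ℂ} (hη2 : η ^ 2 = 1) {α β : MulChar κ ℂ}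
    (h3 : α * β ≠ 1) {l : κ} (hl : l ≠ 0) :
    ∑ b, sqrtTerm α β η l (b, -b) = -(α * β) l⁻¹ := by
  have key : ∀ b : κ, sqrtTerm α β η l (b, -b) =
      (α * β) b - if b = l⁻¹ then (α * β) l⁻¹ else 0 := fun b => by
    by_cases hb0 : b = 0
    · simp [sqrtTerm, hb0, MulChar.map_zero, (inv_ne_zero hl).symm, -zero_eq_inv]
    have e1 : 1 + (-b) ^ 2 * l ^ 2 - b - b - 2 * -b * (1 - l) = 1 * (1 - b * l) ^ 2 := by
      ring
    have e2 : (-b) ^ 2 / b = b := by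
      field_simp
    simp only [sqrtTerm, e1, e2]
    by_cases hb : b = l⁻¹
    · have : 1 - b * l = 0 := by rw [hb]; field_simp; ring
      rw [this, if_pos hb, hb]
      simp [MulChar.map_zero]
    · have : 1 - b * l ≠ 0 := fun h => hb (by field_simp; linear_combination -h)
      rw [quadratic_mul_sq hη2 _ this, if_neg hb, map_one, mul_one, sub_zero, MulChar.mul_apply]
  simp_rw [key, Finset.sum_sub_distrib]
  rw [MulChar.sum_eq_zero_of_ne_one h3]
  simp

lemma sum_sqrtTerm_neg_inv_right {η : MulChar κ ℂ} (hη2 : η ^ 2 = 1) {α β : MulChar κ ℂ}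
    (h4 : α ≠ β * η) {l : κ} (hl : l ≠ 0) :
    ∑ b, sqrtTerm α β η l (b, -l⁻¹) = -((α * β) l⁻¹ * η (-l⁻¹)) := by
  have hne : α⁻¹ * β * η ≠ 1 := fun h => h4 <| by
    rw [mul_assoc, inv_mul_eq_one] at h
    exact h
  have key : ∀ b : κ, sqrtTerm α β η l (b, -l⁻¹) = α l⁻¹ ^ 2 * η (-1) *
      ((α⁻¹ * β * η) b - if b = l⁻¹ then (α⁻¹ * β * η) l⁻¹ else 0) := fun b => by
    by_cases hb0 : b = 0
    · simp [sqrtTerm, hb0, MulChar.map_zero, (inv_ne_zero hl).symm, -zero_eq_inv]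
    have e1 : 1 + (-l⁻¹) ^ 2 * l ^ 2 - (-l⁻¹) ^ 2 / b - b - 2 * -l⁻¹ * (1 - l) =
        (-1 * b) * ((1 - b * l) / (b * l)) ^ 2 := by
      field_simp
      ring
    simp only [sqrtTerm, e1]
    by_cases hb : b = l⁻¹
    · have : 1 - b * l = 0 := by rw [hb]; field_simp; ring
      rw [this, if_pos hb, hb]
      simp [MulChar.map_zero]
    · have : 1 - b * l ≠ 0 := fun h => hb (by field_simp; linear_combination -h)
      rw [quadratic_mul_sq hη2 _ (div_ne_zero this (mul_ne_zero hb0 hl)), if_neg hb, sub_zero,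
        neg_sq, div_eq_mul_inv]
      simp only [map_mul, map_pow, MulChar.mul_apply, MulChar.inv_apply']
      ring
  simp_rw [key, ← Finset.mul_sum, Finset.sum_sub_distrib]
  rw [MulChar.sum_eq_zero_of_ne_one hne]
  have hal : α l ≠ 0 := (hl.isUnit.map α).ne_zero
  have hm : η (-l⁻¹) = η (-1) * η l⁻¹ := by rw [← map_mul, neg_one_mul]
  simp only [Finset.sum_ite_eq', Finset.mem_univ, if_true, hm, MulChar.mul_apply,
    MulChar.inv_apply', mulChar_map_inv, inv_inv]
  field_simp
  ring

lemma sum_sqrtTerm_eq {η : MulChar κ ℂ} (hη2 : η ^ 2 = 1) {α β : MulChar κ ℂ} (h1 : α ^ 2 ≠ 1)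
    (h3 : α * β ≠ 1) (h4 : α ≠ β * η) {l : κ} (hl : l ≠ 0) :
    ∑ p, sqrtTerm α β η l p =
      ∑ p with (p : κ × κ).1 ≠ 0 ∧ p.2 ≠ 0 ∧ 1 - p.1 * l ≠ 0 ∧ p.1 + p.2 ≠ 0 ∧ 1 + p.2 * l ≠ 0,
        sqrtTerm α β η l p +
      (α * β) l⁻¹ * (-η (-l⁻¹) - 1 - η (1 - l⁻¹)) := by
  have hzero : sqrtTerm α β η l (l⁻¹, -l⁻¹) = 0 := by
    have : 1 + (-l⁻¹) ^ 2 * l ^ 2 - (-l⁻¹) ^ 2 / l⁻¹ - l⁻¹ - 2 * -l⁻¹ * (1 - l) = 0 := by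
      field_simp
      ring
    simp only [sqrtTerm, this, MulChar.map_zero, mul_zero]
  have hsplit : ∀ p : κ × κ, sqrtTerm α β η l p =
      (if p.1 ≠ 0 ∧ p.2 ≠ 0 ∧ 1 - p.1 * l ≠ 0 ∧ p.1 + p.2 ≠ 0 ∧ 1 + p.2 * l ≠ 0
        then sqrtTerm α β η l p else 0) +
      ((if p.1 = l⁻¹ then sqrtTerm α β η l p else 0) +
        (if p.2 = -p.1 then sqrtTerm α β η l p else 0) +
        if p.2 = -l⁻¹ then sqrtTerm α β η l p else 0) := by
    rintro ⟨b, c⟩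
    simp only
    have i1 : 1 - b * l = 0 ↔ b = l⁻¹ := by
      rw [← one_div, eq_div_iff hl, sub_eq_zero, eq_comm]
    have i2 : b + c = 0 ↔ c = -b := by rw [add_comm, add_eq_zero_iff_eq_neg]
    have i3 : 1 + c * l = 0 ↔ c = -l⁻¹ := by
      rw [add_comm, add_eq_zero_iff_eq_neg, ← eq_div_iff hl, neg_div, one_div]
    simp only [ne_eq, i1, i2, i3]
    by_cases hb : b = 0
    · simp [sqrtTerm, hb, MulChar.map_zero]
    by_cases hc : c = 0
    · simp [sqrtTerm, hc, MulChar.map_zero]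
    by_cases hbl : b = l⁻¹
    · by_cases hcl : c = -l⁻¹
      · simp [hbl, hcl, hzero]
      · simp [hbl, hcl]
    by_cases hcb : c = -b
    · have : ¬ c = -l⁻¹ := fun h => hbl (neg_injective (hcb.symm.trans h))
      have h5 : ¬ -b = -l⁻¹ := fun h => hbl (neg_injective h)
      simp [hbl, hcb, hb]
    by_cases hcl : c = -l⁻¹ <;> simp [hb, hc, hbl, Ne.symm hbl, hcb, hcl]
  rw [Finset.sum_congr rfl fun p _ => hsplit p, Finset.sum_add_distrib, Finset.sum_filter]
  congr 1
  rw [Fintype.sum_prod_type]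
  simp_rw [Finset.sum_add_distrib]
  have s1 : ∑ b : κ, ∑ c : κ, (if b = l⁻¹ then sqrtTerm α β η l (b, c) else 0) =
      ∑ c, sqrtTerm α β η l (l⁻¹, c) := by
    rw [Finset.sum_comm]
    simp
  have s2 : ∑ b : κ, ∑ c : κ, (if c = -b then sqrtTerm α β η l (b, c) else 0) =
      ∑ b, sqrtTerm α β η l (b, -b) := by simp
  have s3 : ∑ b : κ, ∑ c : κ, (if c = -l⁻¹ then sqrtTerm α β η l (b, c) else 0) =
      ∑ b, sqrtTerm α β η l (b, -l⁻¹) := by simp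
  rw [s1, s2, s3, sum_sqrtTerm_inv_left hη2 β h1 hl, sum_sqrtTerm_antidiagonal hη2 h3 hl,
    sum_sqrtTerm_neg_inv_right hη2 h4 hl]
  ring

lemma sum_eulerTerm_eq_sum_sqrtTerm (hp : ringChar κ ≠ 2) {η : MulChar κ ℂ} (hη2 : η ^ 2 = 1)
    (hη1 : η ≠ 1) {α β : MulChar κ ℂ} (h1 : α ^ 2 ≠ 1) (h3 : α * β ≠ 1) (h4 : α ≠ β * η)
    {l : κ} (hl : l ≠ 0) : ∑ p, eulerTerm α β η l p = ∑ p, sqrtTerm α β η l p := by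
  rw [sum_eulerTerm_eq hp hη2 hη1 α β hl, sum_sqrtTerm_eq hη2 h1 h3 h4 hl,
    sum_eulerTerm_filter hη2]

lemma sum_quadratic_roots_one (hp : ringChar κ ≠ 2) {η : MulChar κ ℂ} (hη2 : η ^ 2 = 1)
    (hη1 : η ≠ 1) (E M : κ) :
    ∑ v : κ, (if v ^ 2 - E * v + M = 0 then (1 : ℂ) else 0) = 1 + η (E ^ 2 - 4 * M) := by
  have h2 : (2 : κ) ≠ 0 := Ring.two_ne_zero hp
  rw [← sum_sqrt_eq hp hη2 hη1]
  refine Fintype.sum_equiv ((Equiv.mulLeft₀ 2 h2).trans (Equiv.subRight E)) _ _ fun v => ?_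
  refine if_congr ?_ rfl rfl
  have e : (2 * v - E) ^ 2 - (E ^ 2 - 4 * M) = 2 ^ 2 * (v ^ 2 - E * v + M) := by ring
  change _ ↔ (2 * v - E) ^ 2 = E ^ 2 - 4 * M
  rw [← sub_eq_zero (a := (2 * v - E) ^ 2), e, mul_eq_zero, or_iff_right (pow_ne_zero 2 h2)]

lemma sum_quadratic_roots_sq (hp : ringChar κ ≠ 2) {η : MulChar κ ℂ} (hη2 : η ^ 2 = 1)
    (hη1 : η ≠ 1) {E m : κ} (hm : m ≠ 0) (hE : E + 2 * m ≠ 0) :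
    ∑ v : κ, (if v ^ 2 - E * v + m ^ 2 = 0 then η v else 0) = η (E + 2 * m) + η (E - 2 * m) := by
  have key : ∀ v : κ, (if v ^ 2 - E * v + m ^ 2 = 0 then η v else 0) =
      η (E + 2 * m) * if v ^ 2 - E * v + m ^ 2 = 0 then (1 : ℂ) else 0 := fun v => by
    split_ifs with h
    · have hv : v ≠ 0 := by
        rintro rfl
        exact hm (by simpa using h)
      have e : v * (E + 2 * m) = (v + m) ^ 2 := by linear_combination -h
      have hvm : v + m ≠ 0 := fun h0 => mul_ne_zero hv hE (by rw [e, h0]; ring)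
      have h5 : η v * η (E + 2 * m) = 1 := by
        rw [← map_mul, e, ← one_mul ((v + m) ^ 2), quadratic_mul_sq hη2 _ hvm, map_one]
      linear_combination -η v * quadratic_mul_self hη2 hE + η (E + 2 * m) * h5
    · rw [mul_zero]
  simp_rw [key, ← Finset.mul_sum]
  rw [sum_quadratic_roots_one hp hη2 hη1, show E ^ 2 - 4 * m ^ 2 = (E + 2 * m) * (E - 2 * m) by ring,
    map_mul]
  linear_combination η (E - 2 * m) * quadratic_mul_self hη2 hE

/-- The sum of `η` over the roots of `v² - E v + M` is the sum of `η (E - 2 m)` over the square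
roots `m` of `M`. -/
lemma sum_quadratic_roots (hp : ringChar κ ≠ 2) {η : MulChar κ ℂ} (hη2 : η ^ 2 = 1)
    (hη1 : η ≠ 1) (E : κ) {M : κ} (hM : M ≠ 0) :
    ∑ v : κ, (if v ^ 2 - E * v + M = 0 then η v else 0) =
      ∑ m : κ, if m ^ 2 = M then η (E - 2 * m) else 0 := by
  have h2 : (2 : κ) ≠ 0 := Ring.two_ne_zero hp
  by_cases hsq : ∃ m, m ^ 2 = M
  · obtain ⟨m, rfl⟩ := hsq
    have hm : m ≠ 0 := fun h => hM (by rw [h]; ring)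
    have hne : m ≠ -m := fun h => mul_ne_zero h2 hm (by linear_combination h)
    have hR : ∑ n : κ, (if n ^ 2 = m ^ 2 then η (E - 2 * n) else 0) =
        η (E + 2 * m) + η (E - 2 * m) := by
      have : ∀ n : κ, (if n ^ 2 = m ^ 2 then η (E - 2 * n) else 0) =
          (if n = m then η (E - 2 * m) else 0) + if n = -m then η (E + 2 * m) else 0 := fun n => by
        simp only [sq_eq_sq_iff_eq_or_eq_neg]
        by_cases h : n = m
        · rw [if_pos (Or.inl h), if_pos h, if_neg (h ▸ hne), h, add_zero]
        · by_cases h' : n = -m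
          · rw [if_pos (Or.inr h'), if_neg h, if_pos h', h', zero_add, mul_neg, sub_neg_eq_add]
          · simp [h, h']
      simp_rw [this, Finset.sum_add_distrib]
      simp [add_comm]
    rw [hR]
    by_cases hE : E + 2 * m = 0
    · have hE' : E + 2 * -m ≠ 0 := fun h =>
        mul_ne_zero (mul_ne_zero h2 h2) hm (by linear_combination hE - h)
      have := sum_quadratic_roots_sq hp hη2 hη1 (neg_ne_zero.2 hm) hE'
      rw [neg_sq, mul_neg, ← sub_eq_add_neg, sub_neg_eq_add] at this
      rw [this, add_comm]
    · exact sum_quadratic_roots_sq hp hη2 hη1 hm hE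
  · have hno : ∀ m : κ, m ^ 2 ≠ M := fun m hm => hsq ⟨m, hm⟩
    have hηM : η M = -1 := by
      have := sum_sqrt_eq hp hη2 hη1 M
      simp only [hno, if_false, Finset.sum_const_zero] at this
      linear_combination -this
    simp only [hno, if_false, Finset.sum_const_zero]
    have hinv : ∑ v : κ, (if v ^ 2 - E * v + M = 0 then η v else 0) =
        ∑ v : κ, -(if v ^ 2 - E * v + M = 0 then η v else 0) := by
      refine Fintype.sum_equiv ((Equiv.inv κ).trans (Equiv.mulLeft₀ M hM)) _ _ fun v => ?_
      change _ = -(if (M * v⁻¹) ^ 2 - E * (M * v⁻¹) + M = 0 then η (M * v⁻¹) else 0)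
      rw [map_mul, quadratic_inv hη2, hηM]
      by_cases hv : v = 0
      · simp [hv, MulChar.map_zero]
      have e : (M * v⁻¹) ^ 2 - E * (M * v⁻¹) + M = M / v ^ 2 * (v ^ 2 - E * v + M) := by
        field_simp
        ring
      have h0 : M / v ^ 2 ≠ 0 := div_ne_zero hM (pow_ne_zero 2 hv)
      simp only [e, mul_eq_zero, h0, false_or]
      split_ifs <;> ring
    rw [Finset.sum_neg_distrib] at hinv
    exact self_eq_neg.1 hinv

lemma sum_sqrtTerm_eq_sum_sqrt (α β η : MulChar κ ℂ) (l : κ) :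
    ∑ p, sqrtTerm α β η l p = ∑ a, ∑ b, α a * β b *
      ∑ c, if c ^ 2 = a * b then η (1 + a * b * l ^ 2 - a - b - 2 * c * (1 - l)) else 0 := by
  rw [Fintype.sum_prod_type, Finset.sum_comm (f := fun a b => α a * β b * _)]
  refine Finset.sum_congr rfl fun b _ => ?_
  by_cases hb : b = 0
  · simp [hb, sqrtTerm, MulChar.map_zero]
  simp_rw [Finset.mul_sum]
  rw [Finset.sum_comm]
  refine Finset.sum_congr rfl fun c _ => ?_
  have key : ∀ a : κ, α a * β b *
      (if c ^ 2 = a * b then η (1 + a * b * l ^ 2 - a - b - 2 * c * (1 - l)) else 0) =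
      if a = c ^ 2 / b then sqrtTerm α β η l (b, c) else 0 := fun a => by
    rw [eq_div_iff hb, eq_comm (a := a * b)]
    split_ifs with h
    · have e : c ^ 2 / b = a := by rw [div_eq_iff hb, h]
      simp only [sqrtTerm, e]
      rw [h]
    · rw [mul_zero]
  simp_rw [key]
  simp

/-- The summand of the character sum over triples `(a, b, v)` with
`v² - (1 + a b l² - a - b) v + a b (1 - l)² = 0`. -/
def quadTerm {F : Type*} [Field F] (α β η : MulChar F ℂ) (l : F) (p : F × F × F) : ℂ :=
  if p.2.2 ^ 2 - (1 + p.1 * p.2.1 * l ^ 2 - p.1 - p.2.1) * p.2.2 + p.1 * p.2.1 * (1 - l) ^ 2 = 0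
    then α p.1 * β p.2.1 * η p.2.2 else 0

lemma sum_sqrtTerm_eq_sum_quadTerm (hp : ringChar κ ≠ 2) {η : MulChar κ ℂ} (hη2 : η ^ 2 = 1)
    (hη1 : η ≠ 1) (α β : MulChar κ ℂ) {l : κ} (hl1 : l ≠ 1) :
    ∑ p, sqrtTerm α β η l p = ∑ p, quadTerm α β η l p := by
  have hl' : 1 - l ≠ 0 := sub_ne_zero.2 hl1.symm
  rw [sum_sqrtTerm_eq_sum_sqrt, Fintype.sum_prod_type]
  simp_rw [Fintype.sum_prod_type]
  refine Finset.sum_congr rfl fun a _ => Finset.sum_congr rfl fun b _ => ?_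
  have hq : ∀ v, quadTerm α β η l (a, b, v) = α a * β b *
      if v ^ 2 - (1 + a * b * l ^ 2 - a - b) * v + a * b * (1 - l) ^ 2 = 0 then η v else 0 :=
    fun v => by simp only [quadTerm, mul_ite, mul_zero]
  simp_rw [hq, ← Finset.mul_sum]
  by_cases ha : a = 0
  · simp [ha, MulChar.map_zero]
  by_cases hb : b = 0
  · simp [hb, MulChar.map_zero]
  rw [sum_quadratic_roots hp hη2 hη1 _ (mul_ne_zero (mul_ne_zero ha hb) (pow_ne_zero 2 hl'))]
  congr 1
  refine Fintype.sum_equiv (Equiv.mulRight₀ (1 - l) hl') _ _ fun c => ?_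
  change _ = if (c * (1 - l)) ^ 2 = _ then η (_ - 2 * (c * (1 - l))) else 0
  rw [mul_pow, ← mul_assoc 2]
  simp only [mul_left_inj' (pow_ne_zero 2 hl')]

/-- The product of the summands of the Euler-type sums for `F(α, β; αβη; l)` and
`F(β, α; αβη; l)`. -/
def prodTerm {F : Type*} [Field F] (α β η : MulChar F ℂ) (l : F) (p : F × F) : ℂ :=
  β p.1 * (α * η) (1 - p.1) * α⁻¹ (1 - p.1 * l) *
    (α p.2 * (β * η) (1 - p.2) * β⁻¹ (1 - p.2 * l))

lemma sum_prodTerm_filter (α β η : MulChar κ ℂ) {l : κ} (hl1 : l ≠ 1) :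
    ∑ p with (p : κ × κ).1 ≠ 0 ∧ p.2 ≠ 0 ∧ 1 - p.1 ≠ 0 ∧ 1 - p.2 ≠ 0 ∧ 1 - p.1 * l ≠ 0 ∧
        1 - p.2 * l ≠ 0 ∧ 1 - l * (p.1 + p.2 - p.1 * p.2) ≠ 0, prodTerm α β η l p =
      ∑ p with (p : κ × κ × κ).1 ≠ 0 ∧ p.2.1 ≠ 0 ∧ p.2.2 ≠ 0 ∧ 1 - p.1 * l ≠ 0 ∧
        1 - p.2.1 * l ≠ 0 ∧ p.2.2 ^ 2 - (1 + p.1 * p.2.1 * l ^ 2 - p.1 - p.2.1) * p.2.2 +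
          p.1 * p.2.1 * (1 - l) ^ 2 = 0, quadTerm α β η l p := by
  have hl' : 1 - l ≠ 0 := sub_ne_zero.2 hl1.symm
  have e1 : ∀ {x y d r : κ}, d ≠ 0 → 1 - x * l = d → 1 - l * (x + y - x * y) = r →
      1 - y * (1 - x) / d * l = r / d := fun hd h h' => by
    field_simp
    rw [← h, ← h']
    ring
  have e2 : ∀ {x y d r : κ}, d ≠ 0 → 1 - x * l = d → 1 - l * (x + y - x * y) = r →
      1 - y * (1 - x) / d - (1 - x) * (1 - y) = x * r / d := fun hd h h' => by
    field_simp
    rw [← h, ← h']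
    ring
  have e3 : ∀ {a v s : κ}, s ≠ 0 → 1 - a * l = s →
      1 - (1 - a - v) / s = (v + a * (1 - l)) / s := fun hs h => by
    field_simp
    rw [← h]
    ring
  have e4 : ∀ {a v s : κ}, s ≠ 0 → 1 - a * l = s →
      1 - (1 - a - v) / s * l = (1 - l + l * v) / s := fun hs h => by
    field_simp
    rw [← h]
    ring
  have n1 : ∀ {a b v : κ}, b ≠ 0 → 1 - a * l ≠ 0 →
      v ^ 2 - (1 + a * b * l ^ 2 - a - b) * v + a * b * (1 - l) ^ 2 = 0 → 1 - a - v ≠ 0 :=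
    fun {a b v} hb ha h h0 => mul_ne_zero hb (pow_ne_zero 2 ha)
      (by linear_combination h + (v - b * l ^ 2 * a + b) * h0)
  have n2 : ∀ {a b v : κ}, a ≠ 0 → 1 - a * l ≠ 0 → 1 - b * l ≠ 0 →
      v ^ 2 - (1 + a * b * l ^ 2 - a - b) * v + a * b * (1 - l) ^ 2 = 0 → v + a * (1 - l) ≠ 0 :=
    fun {a b v} ha hal hbl h h0 => mul_ne_zero (mul_ne_zero (mul_ne_zero ha hl') hal) hbl
      (by linear_combination h - (v - a * (1 - l) - (1 + a * b * l ^ 2 - a - b)) * h0)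
  have n3 : ∀ {a b v : κ}, 1 - a * l ≠ 0 → 1 - b * l ≠ 0 →
      v ^ 2 - (1 + a * b * l ^ 2 - a - b) * v + a * b * (1 - l) ^ 2 = 0 → 1 - l + l * v ≠ 0 :=
    fun {a b v} hal hbl h h0 => mul_ne_zero (mul_ne_zero hl' hal) hbl
      (by linear_combination l ^ 2 * h -
        (l * v - (1 - l) - l * (1 + a * b * l ^ 2 - a - b)) * h0)
  refine Finset.sum_nbij'
    (fun p => (p.2 * (1 - p.1) / (1 - p.1 * l), p.1 * (1 - p.2) / (1 - p.2 * l),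
      (1 - p.1) * (1 - p.2)))
    (fun p => ((1 - p.1 - p.2.2) / (1 - p.1 * l), (1 - p.2.1 - p.2.2) / (1 - p.2.1 * l)))
    ?_ ?_ ?_ ?_ ?_
  · rintro ⟨x, y⟩ h
    simp only [Finset.mem_filter, Finset.mem_univ, true_and] at h ⊢
    obtain ⟨hx, hy, hx1, hy1, hdx, hdy, hr⟩ := h
    have hr' : 1 - l * (y + x - y * x) = 1 - l * (x + y - x * y) := by ring
    rw [e1 hdx rfl rfl, e1 hdy rfl hr']
    refine ⟨by positivity, by positivity, by positivity, by positivity, by positivity, ?_⟩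
    generalize h1 : 1 - x * l = d at hdx
    generalize h2 : 1 - y * l = d' at hdy
    field_simp
    rw [← h1, ← h2]
    ring
  · rintro ⟨a, b, v⟩ h
    simp only [Finset.mem_filter, Finset.mem_univ, true_and] at h ⊢
    obtain ⟨ha, hb, hv, hal, hbl, hq⟩ := h
    have hq' : v ^ 2 - (1 + b * a * l ^ 2 - b - a) * v + b * a * (1 - l) ^ 2 = 0 := by
      linear_combination hq
    have hn := n3 hal hbl hq
    rw [e3 hal rfl, e3 hbl rfl, e4 hal rfl, e4 hbl rfl]
    refine ⟨div_ne_zero (n1 hb hal hq) hal, div_ne_zero (n1 ha hbl hq') hbl,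
      div_ne_zero (n2 ha hal hbl hq) hal, div_ne_zero (n2 hb hbl hal hq') hbl,
      div_ne_zero hn hal, div_ne_zero hn hbl, ?_⟩
    convert hn using 1
    generalize h1 : 1 - a * l = s at hal
    generalize h2 : 1 - b * l = t at hbl
    field_simp
    rw [← h1, ← h2]
    linear_combination l * hq
  · rintro ⟨x, y⟩ h
    simp only [Finset.mem_filter, Finset.mem_univ, true_and] at h ⊢
    obtain ⟨hx, hy, hx1, hy1, hdx, hdy, hr⟩ := h
    have hr' : 1 - l * (y + x - y * x) = 1 - l * (x + y - x * y) := by ring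
    have e5 : (1 - x) * (1 - y) = (1 - y) * (1 - x) := mul_comm _ _
    rw [e1 hdx rfl rfl, e1 hdy rfl hr', e2 hdx rfl rfl, e5, e2 hdy rfl hr']
    generalize 1 - x * l = d at hdx
    generalize 1 - y * l = d' at hdy
    generalize 1 - l * (x + y - x * y) = r at hr
    ext <;> simp only <;> field_simp
  · rintro ⟨a, b, v⟩ h
    simp only [Finset.mem_filter, Finset.mem_univ, true_and] at h ⊢
    obtain ⟨ha, hb, hv, hal, hbl, hq⟩ := h
    have hn := n3 hal hbl hq
    rw [e3 hal rfl, e3 hbl rfl, e4 hal rfl, e4 hbl rfl]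
    generalize h1 : 1 - a * l = s at hal
    generalize h2 : 1 - b * l = t at hbl
    generalize h3 : 1 - l + l * v = u at hn
    ext <;> simp only <;> field_simp
    · rw [← h2, ← h3]
      linear_combination -hq
    · rw [← h1, ← h3]
      linear_combination -hq
    · rw [← h1, ← h2]
      linear_combination hq
  · rintro ⟨x, y⟩ h
    simp only [Finset.mem_filter, Finset.mem_univ, true_and] at h
    obtain ⟨hx, hy, hx1, hy1, hdx, hdy, hr⟩ := h
    have hq : ((1 - x) * (1 - y)) ^ 2 - (1 + y * (1 - x) / (1 - x * l) *
        (x * (1 - y) / (1 - y * l)) * l ^ 2 - y * (1 - x) / (1 - x * l) -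
        x * (1 - y) / (1 - y * l)) * ((1 - x) * (1 - y)) +
        y * (1 - x) / (1 - x * l) * (x * (1 - y) / (1 - y * l)) * (1 - l) ^ 2 = 0 := by
      generalize h1 : 1 - x * l = d at hdx
      generalize h2 : 1 - y * l = d' at hdy
      field_simp
      rw [← h1, ← h2]
      ring
    simp only [quadTerm]
    rw [if_pos hq]
    simp only [prodTerm, MulChar.mul_apply, MulChar.inv_apply', map_mul,
      div_eq_mul_inv]
    ring

lemma sum_prodTerm_eq (α β η : MulChar κ ℂ) {l : κ} (hl : l ≠ 0) (hl1 : l ≠ 1) :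
    ∑ p, prodTerm α β η l p =
      ∑ p with (p : κ × κ).1 ≠ 0 ∧ p.2 ≠ 0 ∧ 1 - p.1 ≠ 0 ∧ 1 - p.2 ≠ 0 ∧ 1 - p.1 * l ≠ 0 ∧
        1 - p.2 * l ≠ 0 ∧ 1 - l * (p.1 + p.2 - p.1 * p.2) ≠ 0, prodTerm α β η l p +
      ((Fintype.card κ : ℂ) - 3) * ((α * β) l⁻¹ * η (1 - l⁻¹)) := by
  have hsplit : ∀ p : κ × κ, prodTerm α β η l p =
      (if p.1 ≠ 0 ∧ p.2 ≠ 0 ∧ 1 - p.1 ≠ 0 ∧ 1 - p.2 ≠ 0 ∧ 1 - p.1 * l ≠ 0 ∧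
        1 - p.2 * l ≠ 0 ∧ 1 - l * (p.1 + p.2 - p.1 * p.2) ≠ 0 then prodTerm α β η l p else 0) +
      if 1 - l * (p.1 + p.2 - p.1 * p.2) = 0 then prodTerm α β η l p else 0 := by
    rintro ⟨x, y⟩
    by_cases h : 1 - l * (x + y - x * y) = 0
    · simp [h]
    by_cases hx : x = 0
    · simp [prodTerm, hx, MulChar.map_zero]
    by_cases hy : y = 0
    · simp [prodTerm, hy, MulChar.map_zero]
    by_cases hx1 : 1 - x = 0
    · simp [prodTerm, hx1, MulChar.map_zero]
    by_cases hy1 : 1 - y = 0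
    · simp [prodTerm, hy1, MulChar.map_zero]
    by_cases hdx : 1 - x * l = 0
    · simp [prodTerm, hdx, MulChar.map_zero]
    by_cases hdy : 1 - y * l = 0
    · simp [prodTerm, hdy, MulChar.map_zero]
    simp [h, hx, hy, hx1, hy1, hdx, hdy]
  have hli : l⁻¹ ≠ 0 := inv_ne_zero hl
  have hli1 : l⁻¹ ≠ 1 := fun h => hl1 (inv_eq_one.1 h)
  have hl' : l - 1 ≠ 0 := sub_ne_zero.2 hl1
  have hcurve : ∀ x : κ,
      ∑ y : κ, (if 1 - l * (x + y - x * y) = 0 then prodTerm α β η l (x, y) else 0) =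
      (α * β) l⁻¹ * η (1 - l⁻¹) * (1 - (if x = 0 then 1 else 0) - (if x = 1 then 1 else 0) -
        if x = l⁻¹ then 1 else 0) := fun x => by
    by_cases hx : x = 0
    · simp [prodTerm, hx, MulChar.map_zero, hli.symm, -zero_eq_inv]
    by_cases hx1 : x = 1
    · simp [prodTerm, hx1, MulChar.map_zero, hli1.symm, -one_eq_inv]
    by_cases hxl : x = l⁻¹
    · simp [prodTerm, hxl, MulChar.map_zero, hl, hli1]
    have hu : 1 - x ≠ 0 := sub_ne_zero.2 (Ne.symm hx1)
    have hd : 1 - x * l ≠ 0 := fun h => hxl (by field_simp; linear_combination -h)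
    have hiff : ∀ y : κ, 1 - l * (x + y - x * y) = 0 ↔ y = (1 - x * l) * l⁻¹ * (1 - x)⁻¹ :=
      fun y => by
        rw [← div_eq_mul_inv, ← div_eq_mul_inv, div_div, eq_div_iff (mul_ne_zero hl hu)]
        constructor <;> intro h <;> linear_combination -h
    simp_rw [hiff]
    rw [Finset.sum_ite_eq' Finset.univ, if_pos (Finset.mem_univ _), if_neg hx, if_neg hx1,
      if_neg hxl]
    have e1 : 1 - (1 - x * l) * l⁻¹ * (1 - x)⁻¹ = (l - 1) * l⁻¹ * (1 - x)⁻¹ := by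
      field_simp
      ring
    have e2 : 1 - (1 - x * l) * l⁻¹ * (1 - x)⁻¹ * l = x * (l - 1) * (1 - x)⁻¹ := by
      field_simp
      ring
    have e3 : 1 - l⁻¹ = (l - 1) * l⁻¹ := by field_simp
    have hne : ∀ (φ : MulChar κ ℂ) {z : κ}, z ≠ 0 → φ z ≠ 0 := fun φ z hz =>
      (hz.isUnit.map φ).ne_zero
    have hαu := hne α hu
    have hβu := hne β hu
    have hηu := hne η hu
    have hαd := hne α hd
    have hβx := hne β hx
    have hβl := hne β hl'
    simp only [prodTerm, e1, e2, e3, MulChar.mul_apply, MulChar.inv_apply', map_mul,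
      mulChar_map_inv, sub_zero, mul_one]
    field_simp
  rw [Finset.sum_congr rfl fun p _ => hsplit p, Finset.sum_add_distrib, Finset.sum_filter]
  congr 1
  rw [Fintype.sum_prod_type]
  simp_rw [hcurve, ← Finset.mul_sum, Finset.sum_sub_distrib]
  simp only [Finset.sum_const, Finset.card_univ, nsmul_eq_mul, mul_one, Finset.sum_ite_eq',
    Finset.mem_univ, if_true]
  ring

lemma quadTerm_comm {F : Type*} [Field F] (α β η : MulChar F ℂ) (l a b v : F) :
    quadTerm α β η l (a, b, v) = quadTerm β α η l (b, a, v) := by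
  have e : v ^ 2 - (1 + a * b * l ^ 2 - a - b) * v + a * b * (1 - l) ^ 2 =
      v ^ 2 - (1 + b * a * l ^ 2 - b - a) * v + b * a * (1 - l) ^ 2 := by ring
  simp only [quadTerm, e, mul_comm (α a)]

lemma sum_quadTerm_inv {η : MulChar κ ℂ} (α β : MulChar κ ℂ) {l : κ} (hl : l ≠ 0) (hl1 : l ≠ 1)
    (b : κ) : ∑ v, quadTerm α β η l (l⁻¹, b, v) = α l⁻¹ * (β b * η (1 - l⁻¹) +
      η (l - 1) * (β * η) b - if b = l⁻¹ then β l⁻¹ * η (1 - l⁻¹) else 0) := by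
  have hl' : l - 1 ≠ 0 := sub_ne_zero.2 hl1
  have hfac : ∀ v : κ, v ^ 2 - (1 + l⁻¹ * b * l ^ 2 - l⁻¹ - b) * v + l⁻¹ * b * (1 - l) ^ 2 =
      (v - (1 - l⁻¹)) * (v - (l - 1) * b) := fun v => by
    field_simp
    ring
  have hroot : (l - 1) * b = 1 - l⁻¹ ↔ b = l⁻¹ := by
    rw [show 1 - l⁻¹ = (l - 1) * l⁻¹ by field_simp, mul_right_inj' hl']
  have key : ∀ v : κ, quadTerm α β η l (l⁻¹, b, v) = α l⁻¹ * β b *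
      ((if v = 1 - l⁻¹ then η (1 - l⁻¹) else 0) + (if v = (l - 1) * b then η ((l - 1) * b) else 0) -
        if v = 1 - l⁻¹ then (if b = l⁻¹ then η (1 - l⁻¹) else 0) else 0) := fun v => by
    simp only [quadTerm, hfac, mul_eq_zero, sub_eq_zero, ← hroot]
    by_cases hv : v = 1 - l⁻¹
    · by_cases hv' : v = (l - 1) * b
      · rw [if_pos (Or.inl hv), if_pos hv, if_pos hv', if_pos hv, if_pos (hv'.symm.trans hv),
          ← hv, ← hv']
        ring
      · rw [if_pos (Or.inl hv), if_pos hv, if_neg hv', if_pos hv,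
          if_neg fun h => hv' (hv.trans h.symm), hv]
        ring
    · by_cases hv' : v = (l - 1) * b
      · rw [if_pos (Or.inr hv'), if_neg hv, if_pos hv', if_neg hv, ← hv']
        ring
      · rw [if_neg (not_or.2 ⟨hv, hv'⟩), if_neg hv, if_neg hv', if_neg hv]
        ring
  simp_rw [key, ← Finset.mul_sum, Finset.sum_sub_distrib, Finset.sum_add_distrib]
  simp only [Finset.sum_ite_eq', Finset.mem_univ, if_true, map_mul, MulChar.mul_apply]
  split_ifs with h
  · rw [h]
    ring
  · ring

lemma sum_sum_quadTerm_inv {η : MulChar κ ℂ} (α : MulChar κ ℂ) {β : MulChar κ ℂ} (hβ : β ≠ 1)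
    (hβη : β * η ≠ 1) {l : κ} (hl : l ≠ 0) (hl1 : l ≠ 1) :
    ∑ b, ∑ v, quadTerm α β η l (l⁻¹, b, v) = -((α * β) l⁻¹ * η (1 - l⁻¹)) := by
  simp_rw [sum_quadTerm_inv α β hl hl1, ← Finset.mul_sum, Finset.sum_sub_distrib,
    Finset.sum_add_distrib, ← Finset.mul_sum, ← Finset.sum_mul]
  rw [MulChar.sum_eq_zero_of_ne_one hβ, MulChar.sum_eq_zero_of_ne_one hβη]
  simp only [Finset.sum_ite_eq', Finset.mem_univ, if_true, MulChar.mul_apply]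
  ring

lemma sum_quadTerm_eq {η : MulChar κ ℂ} {α β : MulChar κ ℂ} (hα : α ≠ 1) (hβ : β ≠ 1)
    (hαη : α * η ≠ 1) (hβη : β * η ≠ 1) {l : κ} (hl : l ≠ 0) (hl1 : l ≠ 1) :
    ∑ p, quadTerm α β η l p =
      ∑ p with (p : κ × κ × κ).1 ≠ 0 ∧ p.2.1 ≠ 0 ∧ p.2.2 ≠ 0 ∧ 1 - p.1 * l ≠ 0 ∧
        1 - p.2.1 * l ≠ 0 ∧ p.2.2 ^ 2 - (1 + p.1 * p.2.1 * l ^ 2 - p.1 - p.2.1) * p.2.2 +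
          p.1 * p.2.1 * (1 - l) ^ 2 = 0, quadTerm α β η l p -
      3 * ((α * β) l⁻¹ * η (1 - l⁻¹)) := by
  have hsplit : ∀ p : κ × κ × κ, quadTerm α β η l p =
      (if p.1 ≠ 0 ∧ p.2.1 ≠ 0 ∧ p.2.2 ≠ 0 ∧ 1 - p.1 * l ≠ 0 ∧
        1 - p.2.1 * l ≠ 0 ∧ p.2.2 ^ 2 - (1 + p.1 * p.2.1 * l ^ 2 - p.1 - p.2.1) * p.2.2 +
          p.1 * p.2.1 * (1 - l) ^ 2 = 0 then quadTerm α β η l p else 0) +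
      ((if p.1 = l⁻¹ then quadTerm α β η l p else 0) +
        (if p.2.1 = l⁻¹ then quadTerm α β η l p else 0) -
        if p.1 = l⁻¹ then (if p.2.1 = l⁻¹ then quadTerm α β η l p else 0) else 0) := by
    rintro ⟨a, b, v⟩
    have i : ∀ b : κ, 1 - b * l = 0 ↔ b = l⁻¹ := fun b => by
      rw [← one_div, eq_div_iff hl, sub_eq_zero, eq_comm]
    simp only [ne_eq, i]
    by_cases ha : a = 0
    · simp [quadTerm, ha, MulChar.map_zero]
    by_cases hb : b = 0
    · simp [quadTerm, hb, MulChar.map_zero]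
    by_cases hv : v = 0
    · simp [quadTerm, hv, MulChar.map_zero]
    by_cases hq : v ^ 2 - (1 + a * b * l ^ 2 - a - b) * v + a * b * (1 - l) ^ 2 = 0
    · generalize quadTerm α β η l (a, b, v) = t
      simp only [ha, hb, hv, hq, not_false_iff, true_and, and_true]
      by_cases hal : a = l⁻¹ <;> by_cases hbl : b = l⁻¹ <;> simp [hal, hbl]
    · have : quadTerm α β η l (a, b, v) = 0 := if_neg hq
      simp [this]
  rw [Finset.sum_congr rfl fun p _ => hsplit p, Finset.sum_add_distrib, Finset.sum_filter]
  simp_rw [Fintype.sum_prod_type, Finset.sum_sub_distrib, Finset.sum_add_distrib]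
  have s1 : ∑ a : κ, ∑ b : κ, ∑ v : κ, (if a = l⁻¹ then quadTerm α β η l (a, b, v) else 0) =
      -((α * β) l⁻¹ * η (1 - l⁻¹)) := by
    rw [← sum_sum_quadTerm_inv α hβ hβη hl hl1, Finset.sum_eq_single l⁻¹]
    · simp
    · intro a _ ha
      simp [ha]
    · simp
  have s2 : ∑ a : κ, ∑ b : κ, ∑ v : κ, (if b = l⁻¹ then quadTerm α β η l (a, b, v) else 0) =
      -((α * β) l⁻¹ * η (1 - l⁻¹)) := by
    rw [mul_comm α β, ← sum_sum_quadTerm_inv β hα hαη hl hl1]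
    refine Finset.sum_congr rfl fun a _ => ?_
    simp_rw [← quadTerm_comm α β]
    rw [Finset.sum_comm]
    simp
  have s3 : ∑ a : κ, ∑ b : κ, ∑ v : κ,
      (if a = l⁻¹ then (if b = l⁻¹ then quadTerm α β η l (a, b, v) else 0) else 0) =
      (α * β) l⁻¹ * η (1 - l⁻¹) := by
    have e : η (l - 1) * (β * η) l⁻¹ = β l⁻¹ * η (1 - l⁻¹) := by
      rw [show 1 - l⁻¹ = (l - 1) * l⁻¹ by field_simp, MulChar.mul_apply, map_mul]
      ring
    have := sum_quadTerm_inv (η := η) α β hl hl1 l⁻¹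
    rw [if_pos rfl, e, add_sub_cancel_right, ← mul_assoc, ← MulChar.mul_apply] at this
    rw [← this, Finset.sum_eq_single l⁻¹, Finset.sum_eq_single l⁻¹]
    · simp
    · intro b _ hb
      simp [hb]
    · simp
    · intro a _ ha
      simp [ha]
    · simp
  rw [s1, s2, s3]
  ring

lemma sum_prodTerm_eq_sum_eulerTerm (hp : ringChar κ ≠ 2) {η : MulChar κ ℂ} (hη2 : η ^ 2 = 1)
    (hη1 : η ≠ 1) {α β : MulChar κ ℂ} (h1 : α ^ 2 ≠ 1) (hα : α ≠ 1) (hβ : β ≠ 1)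
    (hαη : α * η ≠ 1) (hβη : β * η ≠ 1) (h3 : α * β ≠ 1) (h4 : α ≠ β * η) {l : κ} (hl : l ≠ 0)
    (hl1 : l ≠ 1) :
    ∑ p, prodTerm α β η l p =
      ∑ p, eulerTerm α β η l p + Fintype.card κ * ((α * β) l⁻¹ * η (1 - l⁻¹)) := by
  rw [sum_eulerTerm_eq_sum_sqrtTerm hp hη2 hη1 h1 h3 h4 hl,
    sum_sqrtTerm_eq_sum_quadTerm hp hη2 hη1 α β hl1, sum_quadTerm_eq hα hβ hαη hβη hl hl1,
    sum_prodTerm_eq α β η hl hl1, sum_prodTerm_filter α β η hl1]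
  ring

lemma sum_prodTerm_one (α β η : MulChar κ ℂ) :
    ∑ p, prodTerm α β η 1 p = jacobiSum α η * jacobiSum β η := by
  have key : ∀ (φ χ : MulChar κ ℂ) (x : κ),
      φ x * (χ * η) (1 - x) * χ⁻¹ (1 - x * 1) = φ x * η (1 - x) := fun φ χ x => by
    by_cases h : 1 - x = 0
    · simp [h, MulChar.map_zero]
    · have h0 : χ (1 - x) ≠ 0 := ((Ne.isUnit h).map χ).ne_zero
      rw [mul_one, MulChar.mul_apply, MulChar.inv_apply', mulChar_map_inv]
      field_simp
  simp only [prodTerm, key, jacobiSum]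
  rw [mul_comm, Finset.sum_mul_sum, Fintype.sum_prod_type]

lemma sum_eulerTerm_one (hp : ringChar κ ≠ 2) {η : MulChar κ ℂ} (hη2 : η ^ 2 = 1) (hη1 : η ≠ 1)
    {α β : MulChar κ ℂ} (h1 : α ^ 2 ≠ 1) (h3 : α * β ≠ 1) (h4 : α ≠ β * η) :
    ∑ p, eulerTerm α β η 1 p = jacobiSum α η * jacobiSum β η +
      jacobiSum (α * η) η * jacobiSum (β * η) η := by
  rw [sum_eulerTerm_eq_sum_sqrtTerm hp hη2 hη1 h1 h3 h4 one_ne_zero, sum_sqrtTerm_eq_sum_sqrt]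
  simp only [jacobiSum, Finset.sum_mul_sum, ← Finset.sum_add_distrib]
  refine Finset.sum_congr rfl fun a _ => Finset.sum_congr rfl fun b _ => ?_
  have e : ∀ c : κ, 1 + a * b * 1 ^ 2 - a - b - 2 * c * (1 - 1) = (1 - a) * (1 - b) :=
    fun c => by ring
  have hs : ∑ c : κ, (if c ^ 2 = a * b then η ((1 - a) * (1 - b)) else 0) =
      (1 + η (a * b)) * η ((1 - a) * (1 - b)) := by
    rw [← sum_sqrt_eq hp hη2 hη1, Finset.sum_mul]
    simp only [ite_mul, one_mul, zero_mul]
  simp only [e, hs]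
  simp only [map_mul, MulChar.mul_apply]
  ring

lemma Fh_two_one_comm (ψ : AddChar κ ℂ) (α β γ : MulChar κ ℂ) (l : κ) :
    Fh ψ ![α, β] ![γ] l = Fh ψ ![β, α] ![γ] l := by
  simp [Fh, Fin.prod_univ_two, mul_comm]

lemma Fh_sq_eq_sum_prodTerm {ψ : AddChar κ ℂ} (hψ : ψ ≠ 1) {α β η : MulChar κ ℂ} (hα : α ≠ 1)
    (hβ : β ≠ 1) (hαη : α * η ≠ 1) (hβη : β * η ≠ 1) {l : κ} (hl : l ≠ 0) :
    Fh ψ ![α, β] ![α * β * η] l ^ 2 =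
      gSo ψ (α * β * η) / (gS ψ α * gS ψ β) *
        (gSo ψ (α * β * η) / (gS ψ (α * η) * gS ψ (β * η))) * ∑ p, prodTerm α β η l p := by
  have e1 := Fh_two_one_eq_sum hψ β hα hαη hl
  have e2 := Fh_two_one_eq_sum hψ α hβ hβη hl
  rw [← mul_assoc, mul_comm β α] at e1
  rw [← mul_assoc, Fh_two_one_comm] at e2
  have hsum : ∑ p, prodTerm α β η l p =
      (∑ x, β x * (α * η) (1 - x) * α⁻¹ (1 - x * l)) *
        ∑ y, α y * (β * η) (1 - y) * β⁻¹ (1 - y * l) := by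
    rw [Finset.sum_mul_sum, Fintype.sum_prod_type]
    rfl
  rw [pow_two]
  nth_rw 1 [e1]
  rw [e2, hsum]
  simp only [div_eq_mul_inv, mul_inv]
  ring

lemma Fh_three_two_eq_sum_eulerTerm (hp : ringChar κ ≠ 2) {ψ : AddChar κ ℂ} (hψ : ψ ≠ 1)
    {η : MulChar κ ℂ} (hη2 : η ^ 2 = 1) (hη1 : η ≠ 1) {α β : MulChar κ ℂ} (h1 : α ^ 2 ≠ 1)
    (h2 : β ^ 2 ≠ 1) (h3 : α * β ≠ 1) (hα : α ≠ 1) (hβ : β ≠ 1) (hαη : α * η ≠ 1)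
    (hβη : β * η ≠ 1) {l : κ} (hl : l ≠ 0) :
    Fh ψ ![α ^ 2, β ^ 2, α * β] ![α ^ 2 * β ^ 2, α * β * η] l =
      gSo ψ (α * β * η) / (gS ψ α * gS ψ β) *
        (gSo ψ (α * β * η) / (gS ψ (α * η) * gS ψ (β * η))) * ∑ p, eulerTerm α β η l p := by
  have e := Fh_three_two_eq_sum hψ (β ^ 2) (α * β) h1 h1 hη1 hl
  rw [mul_comm (β ^ 2)] at e
  have hsum : ∑ p, eulerTerm α β η l p = ∑ x : κ, (α * β) x * η (1 - x) *
      ∑ y : κ, (β ^ 2) y * (α ^ 2) (1 - y) * (α ^ 2)⁻¹ (1 - y * (x * l)) := by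
    rw [Fintype.sum_prod_type]
    simp_rw [Finset.mul_sum]
    rfl
  rw [e, hsum]
  congr 1
  have dα := gS_duplication hp hψ hη2 hη1 hα
  have dβ := gS_duplication hp hψ hη2 hη1 hβ
  have dαβ := gS_duplication hp hψ hη2 hη1 h3
  rw [gSo_of_ne_one ψ h1, gSo_of_ne_one ψ hαη] at dα
  rw [gSo_of_ne_one ψ h2, gSo_of_ne_one ψ hβη] at dβ
  rw [mul_pow, MulChar.mul_apply] at dαβ
  have h4 : (4 : κ) ≠ 0 := by
    rw [show (4 : κ) = 2 * 2 by norm_num]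
    exact mul_ne_zero (Ring.two_ne_zero hp) (Ring.two_ne_zero hp)
  have hα4 : α 4 ≠ 0 := (h4.isUnit.map α).ne_zero
  have hβ4 : β 4 ≠ 0 := (h4.isUnit.map β).ne_zero
  have n1 := gS_ne_zero hψ α
  have n2 := gS_ne_zero hψ β
  have n3 := gS_ne_zero hψ (α * η)
  have n4 := gS_ne_zero hψ (β * η)
  have n5 := gS_ne_zero hψ (α * β)
  have n6 := gS_ne_zero hψ η
  have f1 : gS ψ (α ^ 2) = α 4 * gS ψ α * gS ψ (α * η) / gS ψ η := by
    rw [dα, mul_div_cancel_left₀ _ n6]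
  have f2 : gS ψ (β ^ 2) = β 4 * gS ψ β * gS ψ (β * η) / gS ψ η := by
    rw [dβ, mul_div_cancel_left₀ _ n6]
  have f3 : gSo ψ (α ^ 2 * β ^ 2) = α 4 * β 4 * gS ψ (α * β) * gSo ψ (α * β * η) / gS ψ η := by
    rw [dαβ, mul_div_cancel_left₀ _ n6]
  rw [f1, f2, f3]
  field_simp

/-- finite-field Clausen formula: in odd characteristic, with `η` the
quadratic character and `α² ≠ ε`, `β² ≠ ε`, `αβ ≠ ε`, `α ≠ βη`, for every `λ ∈ κ*`:
`F(α,β;αβη;λ)² + δ(1-λ)(g°(αβη)g(η)/(g(α)g(β)))²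
  = F(α²,β²,αβ;α²β²,αβη;λ) + q (g°(αβη)/(g(α)g(β))) (g°(αβη)/(g(αη)g(βη))) (αβ)(λ⁻¹)η(1-λ⁻¹)`. -/
theorem stmt_18 (hp : ringChar κ ≠ 2) (ψ : AddChar κ ℂ) (hψ : ψ ≠ 1)
    (η : MulChar κ ℂ) (hη2 : η ^ 2 = 1) (hη1 : η ≠ 1)
    (α β : MulChar κ ℂ) (h1 : α ^ 2 ≠ 1) (h2 : β ^ 2 ≠ 1) (h3 : α * β ≠ 1)
    (h4 : α ≠ β * η) (l : κ) (hl : l ≠ 0) :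
    Fh ψ ![α, β] ![α * β * η] l ^ 2 +
        (if l = 1 then (1 : ℂ) else 0) *
          (gSo ψ (α * β * η) * gS ψ η / (gS ψ α * gS ψ β)) ^ 2 =
      Fh ψ ![α ^ 2, β ^ 2, α * β] ![α ^ 2 * β ^ 2, α * β * η] l +
        (Fintype.card κ : ℂ) * (gSo ψ (α * β * η) / (gS ψ α * gS ψ β)) *
          (gSo ψ (α * β * η) / (gS ψ (α * η) * gS ψ (β * η))) *
          (α * β) l⁻¹ * η (1 - l⁻¹) := by
  have ne_one_of_sq : ∀ {φ : MulChar κ ℂ}, φ ^ 2 ≠ 1 → φ ≠ 1 ∧ φ * η ≠ 1 := fun {φ} h =>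
    ⟨fun h0 => h (by rw [h0, one_pow]), fun h0 => h (by
      have h5 := congrArg (· ^ 2) h0
      simpa only [mul_pow, hη2, mul_one, one_pow] using h5)⟩
  obtain ⟨hα, hαη⟩ := ne_one_of_sq h1
  obtain ⟨hβ, hβη⟩ := ne_one_of_sq h2
  rw [Fh_sq_eq_sum_prodTerm hψ hα hβ hαη hβη hl,
    Fh_three_two_eq_sum_eulerTerm hp hψ hη2 hη1 h1 h2 h3 hα hβ hαη hβη hl]
  by_cases hl1 : l = 1
  · subst hl1
    have hηη : ∀ φ : MulChar κ ℂ, φ * η * η = φ := fun φ => by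
      rw [mul_assoc, ← pow_two, hη2, mul_one]
    have jα := jacobiSum_mul_gSo hψ (α * η) hη1
    have jβ := jacobiSum_mul_gSo hψ (β * η) hη1
    rw [hηη, gSo_of_ne_one ψ hα] at jα
    rw [hηη, gSo_of_ne_one ψ hβ] at jβ
    have n1 := gS_ne_zero hψ α
    have n2 := gS_ne_zero hψ β
    have n3 := gS_ne_zero hψ (α * η)
    have n4 := gS_ne_zero hψ (β * η)
    rw [sum_prodTerm_one, sum_eulerTerm_one hp hη2 hη1 h1 h3 h4, if_pos rfl, inv_one, sub_self,
      MulChar.map_zero, eq_div_of_mul_eq n1 jα, eq_div_of_mul_eq n2 jβ]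
    field_simp
    ring
  · rw [if_neg hl1,
      sum_prodTerm_eq_sum_eulerTerm hp hη2 hη1 h1 hα hβ hαη hβη h3 h4 hl hl1]
    ring

end
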